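/- Let x ∈ S_n be a maximal singular point (MSP) for w ∈ S_n with Δ(x,w) = {1,…,n}, and suppose x consists of exactly two decreasing sequences, i.e. x = [k,k−1,…,1, k+m,k+m−1,…,k+1] in one-line notation for some k,m ≥ 1 with k + m = n. Then k ≥ 2, m ≥ 2, and w = [k+m, k,k−1,…,2, k+m−1,k+m−2,…,k+1, 1]. -/

import Mathlib

open scoped Classical

namespace BSW

/-- The number of inversions (the length) of a permutation of `Fin n`. -/
def invLen {n : ℕ} (w : Equiv.Perm (Fin n)) : ℕ :=
  (Finset.univ.filter (fun p : Fin n × Fin n => p.1 < p.2 ∧ w p.2 < w p.1)).card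

/-- The rank function `r_w(p,q) = #{i : 1 ≤ i ≤ p and w(i) ≥ q}`, where the
permutation of `Fin n` is regarded as a permutation of `{1,…,n}` (so position
`i : Fin n` corresponds to `i+1` and value `w i` to `(w i)+1`). -/
def rank {n : ℕ} (w : Equiv.Perm (Fin n)) (p q : ℤ) : ℕ :=
  (Finset.univ.filter (fun i : Fin n =>
    ((i : ℕ) : ℤ) + 1 ≤ p ∧ q ≤ ((w i : ℕ) : ℤ) + 1)).card

/-- The difference function `d_{x,w}(p,q) = r_w(p,q) − r_x(p,q)`. -/
def dxw {n : ℕ} (x w : Equiv.Perm (Fin n)) (p q : ℤ) : ℤ :=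
  (rank w p q : ℤ) - (rank x p q : ℤ)

/-- The Bruhat order: `x ≤ w` iff `d_{x,w}` is everywhere non-negative. -/
def bruhatLE {n : ℕ} (x w : Equiv.Perm (Fin n)) : Prop :=
  ∀ p q : ℤ, 0 ≤ dxw x w p q

/-- The set of transpositions in `S_n`. -/
def transpositions (n : ℕ) : Set (Equiv.Perm (Fin n)) :=
  {t | ∃ a b : Fin n, a ≠ b ∧ t = Equiv.swap a b}

/-- `R(x,w) = {t ∈ T : l(xt) > l(x) and xt ≤ w}`. -/
def R {n : ℕ} (x w : Equiv.Perm (Fin n)) : Set (Equiv.Perm (Fin n)) :=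
  {t | t ∈ transpositions n ∧ invLen x < invLen (x * t) ∧ bruhatLE (x * t) w}

/-- `x` is a maximal singular point (MSP) for `w`. -/
def MSP {n : ℕ} (x w : Equiv.Perm (Fin n)) : Prop :=
  bruhatLE x w ∧ ((invLen w : ℤ) - (invLen x : ℤ) < ((R x w).ncard : ℤ)) ∧
    ∀ t ∈ R x w, ((R (x * t) w).ncard : ℤ) = (invLen w : ℤ) - (invLen (x * t) : ℤ)

/-- `Δ(x,w) = {i : t_{{i,j}} ∈ R(x,w) for some j}`. -/
def Delta {n : ℕ} (x w : Equiv.Perm (Fin n)) : Set (Fin n) :=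
  {i | ∃ j : Fin n, Equiv.swap i j ∈ R x w}

/-- `Δ(x,w)` as a finset. -/
noncomputable def DeltaFinset {n : ℕ} (x w : Equiv.Perm (Fin n)) : Finset (Fin n) :=
  (Set.toFinite (Delta x w)).toFinset

/-- `σ ∈ S_k` is the flattening of `x` along the increasing enumeration `d_1 < … < d_k`
of a set `D` of positions with `#D = k`: the unique permutation of `{1,…,k}` with
`σ(a) < σ(b)` iff `x(d_a) < x(d_b)`. -/
def IsFlatteningOn {n k : ℕ} (x : Equiv.Perm (Fin n)) (D : Finset (Fin n))
    (hD : D.card = k) (σ : Equiv.Perm (Fin k)) : Prop :=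
  ∀ a b : Fin k, σ a < σ b ↔ x ((D.orderIsoOfFin hD a : Fin n)) < x ((D.orderIsoOfFin hD b : Fin n))

/-- Values (0-indexed) of the permutation `x_{k,m} = [k,…,1, k+m,…,k+1]`. -/
def xkmVal (k m i : ℕ) : ℕ :=
  if i < k then k - 1 - i else 2 * k + m - 1 - i

/-- Values (0-indexed) of the permutation `w_{k,m} = [k+m, k,…,2, k+m−1,…,k+1, 1]`. -/
def wkmVal (k m i : ℕ) : ℕ :=
  if i = 0 then k + m - 1
  else if i < k then k - i
  else if i < k + m - 1 then 2 * k + m - 2 - i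
  else 0

/-- Values (0-indexed) of the permutation `x_{k,l,m} = [k,…,1, k+l,…,k+1, k+l+m,…,k+l+1]`. -/
def xklmVal (k l m i : ℕ) : ℕ :=
  if i < k then k - 1 - i
  else if i < k + l then 2 * k + l - 1 - i
  else 2 * (k + l) + m - 1 - i

/-- Values (0-indexed) of the permutation
`w_{k,l,m} = [k+l, k,…,2, k+l+m, k+l−1,…,k+2, 1, k+l+m−1,…,k+l+1, k+1]`. -/
def wklmVal (k l m i : ℕ) : ℕ :=
  if i = 0 then k + l - 1
  else if i < k then k - i
  else if i = k then k + l + m - 1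
  else if i < k + l - 1 then 2 * k + l - 1 - i
  else if i = k + l - 1 then 0
  else if i < k + l + m - 1 then 2 * (k + l) + m - 2 - i
  else k


lemma rank_eq_sum {n : ℕ} (y : Equiv.Perm (Fin n)) (p q : ℤ) :
    (rank y p q : ℤ) =
      ∑ i : Fin n, if ((i : ℕ) : ℤ) + 1 ≤ p ∧ q ≤ ((y i : ℕ) : ℤ) + 1 then (1 : ℤ) else 0 := by
  simp [rank, Finset.sum_boole]

lemma invLen_eq_sum {n : ℕ} (y : Equiv.Perm (Fin n)) :
    (invLen y : ℤ) =
      ∑ i : Fin n, ∑ j : Fin n, if i < j ∧ y j < y i then (1 : ℤ) else 0 := by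
  rw [← Finset.sum_product', Finset.univ_product_univ]
  simp [invLen, Finset.sum_boole]

/-- A double sum over pairs meeting `{a, b}`, by inclusion-exclusion. -/
lemma sum_sum_eq_of_meets {n : ℕ} (F : Fin n → Fin n → ℤ) {a b : Fin n} (hab : a ≠ b)
    (h0 : ∀ i j, i ≠ a → i ≠ b → j ≠ a → j ≠ b → F i j = 0) :
    ∑ i, ∑ j, F i j =
      ∑ c, (F c a + F c b + F a c + F b c) - (F a a + F a b + F b a + F b b) := by
  have h1 : ∑ i, (∑ j, F i j - F i a - F i b) =
      (∑ j, F a j - F a a - F a b) + (∑ j, F b j - F b a - F b b) := by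
    refine Fintype.sum_eq_add a b hab fun i hi => ?_
    rw [Fintype.sum_eq_add a b hab fun j hj => h0 i j hi.1 hi.2 hj.1 hj.2]
    ring
  simp only [Finset.sum_sub_distrib, Finset.sum_add_distrib] at h1 ⊢
  linarith

/-- The box of points at which the rank function grows when passing from `y` to
`y * swap a b`. -/
def InBox {n : ℕ} (y : Equiv.Perm (Fin n)) (a b : Fin n) (p q : ℤ) : Prop :=
  ((a : ℕ) : ℤ) + 1 ≤ p ∧ p ≤ ((b : ℕ) : ℤ) ∧
    ((y a : ℕ) : ℤ) + 1 < q ∧ q ≤ ((y b : ℕ) : ℤ) + 1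

lemma dxw_mul_swap {n : ℕ} (y w : Equiv.Perm (Fin n)) {a b : Fin n} (hab : a < b)
    (hy : y a < y b) (p q : ℤ) :
    dxw (y * Equiv.swap a b) w p q = dxw y w p q - if InBox y a b p q then 1 else 0 := by
  have key : (rank (y * Equiv.swap a b) p q : ℤ) - rank y p q =
      if InBox y a b p q then 1 else 0 := by
    rw [rank_eq_sum, rank_eq_sum, ← Finset.sum_sub_distrib,
      Fintype.sum_eq_add a b hab.ne fun c hc => ?_]
    · simp only [Equiv.Perm.mul_apply, Equiv.swap_apply_left, Equiv.swap_apply_right, InBox]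
      rw [Fin.lt_def] at hab hy
      split_ifs <;> omega
    · simp [Equiv.swap_apply_of_ne_of_ne hc.1 hc.2]
  simp only [dxw]
  linarith

/-- No position strictly between `a` and `b` carries a value strictly between `y a` and `y b`. -/
def NoneBetween {n : ℕ} (y : Equiv.Perm (Fin n)) (a b : Fin n) : Prop :=
  ∀ c, a < c → c < b → y a < y c → y c < y b → False

lemma swap_inversion_count {α β : Type*} [LinearOrder α] [LinearOrder β] {a b c : α}
    {u v z : β} (hab : a < b) (huv : u < v) (hca : c ≠ a) (hcb : c ≠ b) (hzu : z ≠ u)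
    (hzv : z ≠ v) :
    ((if c < b ∧ u < z then (1 : ℤ) else 0) - if c < a ∧ u < z then 1 else 0) +
      ((if c < a ∧ v < z then 1 else 0) - if c < b ∧ v < z then 1 else 0) +
      ((if b < c ∧ z < u then 1 else 0) - if a < c ∧ z < u then 1 else 0) +
      ((if a < c ∧ z < v then 1 else 0) - if b < c ∧ z < v then 1 else 0) =
      if a < c ∧ c < b ∧ u < z ∧ z < v then 2 else 0 := by
  have pos : c < a ∧ c < b ∨ a < c ∧ c < b ∨ a < c ∧ b < c := by
    rcases lt_or_gt_of_ne hca with h | h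
    · exact Or.inl ⟨h, h.trans hab⟩
    · rcases lt_or_gt_of_ne hcb with h' | h'
      exacts [Or.inr (Or.inl ⟨h, h'⟩), Or.inr (Or.inr ⟨h, h'⟩)]
  have val : z < u ∧ z < v ∨ u < z ∧ z < v ∨ u < z ∧ v < z := by
    rcases lt_or_gt_of_ne hzu with h | h
    · exact Or.inl ⟨h, h.trans huv⟩
    · rcases lt_or_gt_of_ne hzv with h' | h'
      exacts [Or.inr (Or.inl ⟨h, h'⟩), Or.inr (Or.inr ⟨h, h'⟩)]
  rcases pos with ⟨h1, h2⟩ | ⟨h1, h2⟩ | ⟨h1, h2⟩ <;>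
    rcases val with ⟨h3, h4⟩ | ⟨h3, h4⟩ | ⟨h3, h4⟩ <;>
    simp [h1, h2, h3, h4, h1.not_gt, h2.not_gt, h3.not_gt, h4.not_gt]

lemma invLen_mul_swap {n : ℕ} (y : Equiv.Perm (Fin n)) {a b : Fin n} (hab : a < b)
    (hy : y a < y b) :
    (invLen y : ℤ) + 1 ≤ invLen (y * Equiv.swap a b) ∧
      (NoneBetween y a b → (invLen (y * Equiv.swap a b) : ℤ) = invLen y + 1) := by
  set s := Equiv.swap a b with hs
  have hsa : s a = b := Equiv.swap_apply_left a b
  have hsb : s b = a := Equiv.swap_apply_right a b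
  have hsc : ∀ c, c ≠ a → c ≠ b → s c = c := fun c => Equiv.swap_apply_of_ne_of_ne
  let F : Fin n → Fin n → ℤ := fun i j =>
    (if s i < s j ∧ y j < y i then (1 : ℤ) else 0) - if i < j ∧ y j < y i then (1 : ℤ) else 0
  have h1 : (invLen (y * s) : ℤ) =
      ∑ i : Fin n, ∑ j : Fin n, if s i < s j ∧ y j < y i then (1 : ℤ) else 0 := by
    rw [invLen_eq_sum, ← Equiv.sum_comp s]
    refine Finset.sum_congr rfl fun i _ => ?_
    rw [← Equiv.sum_comp s]
    refine Finset.sum_congr rfl fun j _ => ?_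
    simp [hs]
  have h2 : (invLen (y * s) : ℤ) - invLen y = ∑ i, ∑ j, F i j := by
    rw [h1, invLen_eq_sum]
    simp only [F, Finset.sum_sub_distrib]
  rw [sum_sum_eq_of_meets F hab.ne fun i j hia hib hja hjb => by
    simp [F, hsc i hia hib, hsc j hja hjb]] at h2
  have hcorner : F a a + F a b + F b a + F b b = 1 := by
    simp [F, hsa, hsb, hab, hab.not_gt, hy, hy.not_gt]
  have hKa : F a a + F a b + F a a + F b a = 1 := by
    simp [F, hsa, hsb, hab, hab.not_gt, hy, hy.not_gt]
  have hKb : F b a + F b b + F a b + F b b = 1 := by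
    simp [F, hsa, hsb, hab, hab.not_gt, hy, hy.not_gt]
  have hK : ∀ c, c ≠ a ∧ c ≠ b → F c a + F c b + F a c + F b c =
      if a < c ∧ c < b ∧ y a < y c ∧ y c < y b then 2 else 0 := by
    intro c hc
    have hya : y c ≠ y a := fun h => hc.1 (y.injective h)
    have hyb : y c ≠ y b := fun h => hc.2 (y.injective h)
    simp only [F, hsa, hsb, hsc c hc.1 hc.2]
    exact swap_inversion_count hab hy hc.1 hc.2 hya hyb
  have hsum : ∑ c, (F c a + F c b + F a c + F b c) =
      2 + ∑ c, if a < c ∧ c < b ∧ y a < y c ∧ y c < y b then 2 else 0 := by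
    rw [← sub_eq_iff_eq_add, ← Finset.sum_sub_distrib,
      Fintype.sum_eq_add a b hab.ne fun c hc => by rw [hK c hc, sub_self], hKa, hKb]
    simp
  rw [hsum, hcorner] at h2
  constructor
  · have : (0 : ℤ) ≤ ∑ c, if a < c ∧ c < b ∧ y a < y c ∧ y c < y b then 2 else 0 :=
      Finset.sum_nonneg fun c _ => by split_ifs <;> norm_num
    omega
  · intro hnone
    have : (∑ c, if a < c ∧ c < b ∧ y a < y c ∧ y c < y b then (2 : ℤ) else 0) = 0 :=
      Finset.sum_eq_zero fun c _ => if_neg fun h => hnone c h.1 h.2.1 h.2.2.1 h.2.2.2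
    omega

lemma swap_mem_R_iff {n : ℕ} {y w : Equiv.Perm (Fin n)} (hyw : bruhatLE y w) {a b : Fin n}
    (hab : a < b) :
    Equiv.swap a b ∈ R y w ↔ y a < y b ∧ ∀ p q, InBox y a b p q → 1 ≤ dxw y w p q := by
  constructor
  · rintro ⟨-, hlen, hle⟩
    have hy : y a < y b := by
      by_contra! h
      have hlt : y b < y a := lt_of_le_of_ne h fun h' => hab.ne' (y.injective h')
      have := (invLen_mul_swap (y * Equiv.swap a b) hab (by simpa using hlt)).1
      simp only [mul_assoc, Equiv.swap_mul_self, mul_one] at this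
      omega
    refine ⟨hy, fun p q hpq => ?_⟩
    have := hle p q
    rw [dxw_mul_swap y w hab hy, if_pos hpq] at this
    omega
  · rintro ⟨hy, hbox⟩
    refine ⟨⟨a, b, hab.ne, rfl⟩, ?_, fun p q => ?_⟩
    · have := (invLen_mul_swap y hab hy).1
      omega
    · rw [dxw_mul_swap y w hab hy]
      split_ifs with h
      · have := hbox p q h
        omega
      · have := hyw p q
        omega
lemma swap_swap_mem_R {n : ℕ} {y w : Equiv.Perm (Fin n)} {a b c : Fin n} (hyw : bruhatLE y w)
    (hab : a < b) (hs : Equiv.swap a b ∈ R y w) (hn : NoneBetween y a b) (hca : c ≠ a)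
    (hcb : c ≠ b) :
    (Equiv.swap c a ∈ R (y * Equiv.swap a b) w ∨ Equiv.swap c b ∈ R (y * Equiv.swap a b) w →
        Equiv.swap c a ∈ R y w ∨ Equiv.swap c b ∈ R y w) ∧
      (Equiv.swap c a ∈ R (y * Equiv.swap a b) w → Equiv.swap c b ∈ R (y * Equiv.swap a b) w →
        Equiv.swap c a ∈ R y w ∧ Equiv.swap c b ∈ R y w) := by
  have hle := hs.2.2
  obtain ⟨hy, hbox⟩ := (swap_mem_R_iff hyw hab).1 hs
  have hya : y c ≠ y a := fun h => hca (y.injective h)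
  have hyb : y c ≠ y b := fun h => hcb (y.injective h)
  have va : (y * Equiv.swap a b) a = y b := by simp
  have vb : (y * Equiv.swap a b) b = y a := by simp
  have vc : (y * Equiv.swap a b) c = y c := by simp [Equiv.swap_apply_of_ne_of_ne hca hcb]
  have hd := dxw_mul_swap y w hab hy
  have hnc := hn c
  rcases lt_or_gt_of_ne hca with h1 | h1
  · have h2 : c < b := h1.trans hab
    simp only [swap_mem_R_iff hyw h1, swap_mem_R_iff hyw h2, swap_mem_R_iff hle h1,
      swap_mem_R_iff hle h2, hd, InBox, va, vb, vc] at hbox ⊢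
    clear hd hs hle va vb vc hn hyw
    simp only [ne_eq, Fin.ext_iff, Fin.lt_def] at *
    constructor
    · rintro (⟨hv, h⟩ | ⟨hv, h⟩)
      · by_cases hlt : (y c : ℕ) < y a
        · refine Or.inl ⟨hlt, fun p q hpq => ?_⟩
          have := h p q
          split_ifs at this <;> omega
        · refine Or.inr ⟨hv, fun p q hpq => ?_⟩
          have := h p q
          have := hbox p q
          split_ifs at * <;> omega
      · refine Or.inl ⟨hv, fun p q hpq => ?_⟩
        have := h p q
        split_ifs at this <;> omega
    · rintro ⟨hv, h⟩ ⟨hv', h'⟩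
      refine ⟨⟨hv', fun p q hpq => ?_⟩, ⟨hv, fun p q hpq => ?_⟩⟩ <;>
      · have h3 := h p q
        have h4 := h' p q
        have h5 := hbox p q
        split_ifs at h3 h4 <;> omega
  · rcases lt_or_gt_of_ne hcb with h2 | h2
    · rw [Equiv.swap_comm c a]
      simp only [swap_mem_R_iff hyw h1, swap_mem_R_iff hyw h2, swap_mem_R_iff hle h1,
        swap_mem_R_iff hle h2, hd, InBox, va, vb, vc] at hbox ⊢
      clear hd hs hle va vb vc hn hyw
      simp only [ne_eq, Fin.ext_iff, Fin.lt_def] at *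
      constructor
      · rintro (⟨hv, h⟩ | ⟨hv, h⟩)
        · refine Or.inl ⟨by omega, fun p q hpq => ?_⟩
          have := h p q
          have := hbox p q
          split_ifs at * <;> omega
        · refine Or.inr ⟨by omega, fun p q hpq => ?_⟩
          have := h p q
          have := hbox p q
          split_ifs at * <;> omega
      · rintro ⟨hv, h⟩ ⟨hv', h'⟩
        omega
    · rw [Equiv.swap_comm c a, Equiv.swap_comm c b]
      simp only [swap_mem_R_iff hyw h1, swap_mem_R_iff hyw h2, swap_mem_R_iff hle h1,
        swap_mem_R_iff hle h2, hd, InBox, va, vb, vc] at hbox ⊢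
      clear hd hs hle va vb vc hn hyw
      simp only [ne_eq, Fin.ext_iff, Fin.lt_def] at *
      constructor
      · rintro (⟨hv, h⟩ | ⟨hv, h⟩)
        · refine Or.inr ⟨hv, fun p q hpq => ?_⟩
          have := h p q
          split_ifs at this <;> omega
        · by_cases hlt : (y b : ℕ) < y c
          · refine Or.inr ⟨hlt, fun p q hpq => ?_⟩
            have := h p q
            split_ifs at this <;> omega
          · refine Or.inl ⟨hv, fun p q hpq => ?_⟩
            have := h p q
            have := hbox p q
            split_ifs at * <;> omega
      · rintro ⟨hv, h⟩ ⟨hv', h'⟩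
        refine ⟨⟨hv', fun p q hpq => ?_⟩, ⟨hv, fun p q hpq => ?_⟩⟩ <;>
        · have h3 := h p q
          have h4 := h' p q
          have h5 := hbox p q
          split_ifs at h3 h4 <;> omega

/-- A transposition either commutes with `swap a b`, or moves exactly one of `a`, `b`, or is
`swap a b` itself. -/
lemma transposition_cases {n : ℕ} {a b : Fin n} {g : Equiv.Perm (Fin n)}
    (hg : g ∈ transpositions n) :
    (∃ i j, i ≠ j ∧ i ≠ a ∧ i ≠ b ∧ j ≠ a ∧ j ≠ b ∧ g = Equiv.swap i j) ∨
      (∃ c, c ≠ a ∧ c ≠ b ∧ (g = Equiv.swap c a ∨ g = Equiv.swap c b)) ∨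
      g = Equiv.swap a b := by
  obtain ⟨i, j, hij, rfl⟩ := hg
  by_cases hia : i = a
  · subst hia
    by_cases hjb : j = b
    · exact Or.inr (Or.inr (by rw [hjb]))
    · exact Or.inr (Or.inl ⟨j, hij.symm, hjb, Or.inl (Equiv.swap_comm _ _)⟩)
  by_cases hib : i = b
  · subst hib
    by_cases hja : j = a
    · exact Or.inr (Or.inr (by rw [hja, Equiv.swap_comm]))
    · exact Or.inr (Or.inl ⟨j, hja, hij.symm, Or.inr (Equiv.swap_comm _ _)⟩)
  by_cases hja : j = a
  · exact Or.inr (Or.inl ⟨i, hia, hib, Or.inl (by rw [hja])⟩)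
  by_cases hjb : j = b
  · exact Or.inr (Or.inl ⟨i, hia, hib, Or.inr (by rw [hjb])⟩)
  exact Or.inl ⟨i, j, hij, hia, hib, hja, hjb, rfl⟩

lemma conj_swap_left {n : ℕ} {a b c : Fin n} (hca : c ≠ a) (hcb : c ≠ b) :
    Equiv.swap a b * Equiv.swap c a * Equiv.swap a b = Equiv.swap c b := by
  have := Equiv.swap_apply_apply (Equiv.swap a b) c a
  rw [Equiv.swap_apply_of_ne_of_ne hca hcb, Equiv.swap_apply_left, Equiv.swap_inv] at this
  exact this.symm

lemma conj_swap_right {n : ℕ} {a b c : Fin n} (hca : c ≠ a) (hcb : c ≠ b) :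
    Equiv.swap a b * Equiv.swap c b * Equiv.swap a b = Equiv.swap c a := by
  rw [Equiv.swap_comm a b]
  exact conj_swap_left hcb hca

lemma conj_swap_disjoint {n : ℕ} {a b i j : Fin n} (hia : i ≠ a) (hib : i ≠ b) (hja : j ≠ a)
    (hjb : j ≠ b) :
    Equiv.swap a b * Equiv.swap i j * Equiv.swap a b = Equiv.swap i j := by
  have := Equiv.swap_apply_apply (Equiv.swap a b) i j
  rw [Equiv.swap_apply_of_ne_of_ne hia hib, Equiv.swap_apply_of_ne_of_ne hja hjb,
    Equiv.swap_inv] at this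
  exact this.symm

lemma swap_mem_R_of_disjoint {n : ℕ} {y w : Equiv.Perm (Fin n)} {a b i j : Fin n}
    (hyw : bruhatLE y w) (hab : a < b) (hs : Equiv.swap a b ∈ R y w) (hij : i ≠ j)
    (hia : i ≠ a) (hib : i ≠ b) (hja : j ≠ a) (hjb : j ≠ b)
    (hg : Equiv.swap i j ∈ R (y * Equiv.swap a b) w) : Equiv.swap i j ∈ R y w := by
  wlog hlt : i < j generalizing i j
  · rw [Equiv.swap_comm i j] at hg ⊢
    exact this hij.symm hja hjb hia hib hg (lt_of_le_of_ne (not_lt.1 hlt) hij.symm)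
  have hd := dxw_mul_swap y w hab ((swap_mem_R_iff hyw hab).1 hs).1
  obtain ⟨hv, h⟩ := (swap_mem_R_iff hs.2.2 hlt).1 hg
  have vi : (y * Equiv.swap a b) i = y i := by simp [Equiv.swap_apply_of_ne_of_ne hia hib]
  have vj : (y * Equiv.swap a b) j = y j := by simp [Equiv.swap_apply_of_ne_of_ne hja hjb]
  simp only [vi, vj, InBox] at hv h
  refine (swap_mem_R_iff hyw hlt).2 ⟨hv, fun p q hpq => ?_⟩
  have := h p q hpq
  rw [hd] at this
  split_ifs at this <;> omega

lemma swap_notMem_R_mul_swap {n : ℕ} {y w : Equiv.Perm (Fin n)} {a b : Fin n}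
    (hs : Equiv.swap a b ∈ R y w) : Equiv.swap a b ∉ R (y * Equiv.swap a b) w := by
  rintro ⟨-, h, -⟩
  have := hs.2.1
  simp only [mul_assoc, Equiv.swap_mul_self, mul_one] at h
  omega

/-- Going up along a Bruhat cover `y < y * swap a b`, a transposition counted at the top is
moved, if necessary, by conjugation to one counted at the bottom. -/
noncomputable def pull {n : ℕ} (y w : Equiv.Perm (Fin n)) (a b : Fin n)
    (g : Equiv.Perm (Fin n)) : Equiv.Perm (Fin n) :=
  if g ∈ R y w then g else Equiv.swap a b * g * Equiv.swap a b

lemma conj_conj_swap {n : ℕ} (a b : Fin n) (g : Equiv.Perm (Fin n)) :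
    Equiv.swap a b * (Equiv.swap a b * g * Equiv.swap a b) * Equiv.swap a b = g := by
  simp [mul_assoc]

lemma conj_mem_R {n : ℕ} {y w : Equiv.Perm (Fin n)} {a b : Fin n} (hyw : bruhatLE y w)
    (hab : a < b) (hs : Equiv.swap a b ∈ R y w) (hn : NoneBetween y a b)
    {g : Equiv.Perm (Fin n)} (hg : g ∈ R (y * Equiv.swap a b) w) :
    (g ∈ R y w ∨ Equiv.swap a b * g * Equiv.swap a b ∈ R y w) ∧
      (Equiv.swap a b * g * Equiv.swap a b ∈ R (y * Equiv.swap a b) w → g ∈ R y w) := by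
  rcases transposition_cases (a := a) (b := b) hg.1 with
    ⟨i, j, hij, hia, hib, hja, hjb, rfl⟩ | ⟨c, hca, hcb, rfl | rfl⟩ | rfl
  · have := swap_mem_R_of_disjoint hyw hab hs hij hia hib hja hjb hg
    exact ⟨Or.inl this, fun _ => this⟩
  · have := swap_swap_mem_R hyw hab hs hn hca hcb
    rw [conj_swap_left hca hcb]
    exact ⟨this.1 (Or.inl hg), fun h => (this.2 hg h).1⟩
  · have := swap_swap_mem_R hyw hab hs hn hca hcb
    rw [conj_swap_right hca hcb]
    exact ⟨(this.1 (Or.inr hg)).symm, fun h => (this.2 h hg).2⟩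
  · exact absurd hg (swap_notMem_R_mul_swap hs)

lemma pull_mapsTo {n : ℕ} {y w : Equiv.Perm (Fin n)} {a b : Fin n} (hyw : bruhatLE y w)
    (hab : a < b) (hs : Equiv.swap a b ∈ R y w) (hn : NoneBetween y a b) :
    Set.MapsTo (pull y w a b) (R (y * Equiv.swap a b) w) (R y w \ {Equiv.swap a b}) := by
  intro g hg
  have hne : g ≠ Equiv.swap a b := by
    rintro rfl
    exact swap_notMem_R_mul_swap hs hg
  unfold pull
  split_ifs with h
  · exact ⟨h, hne⟩
  · refine ⟨((conj_mem_R hyw hab hs hn hg).1).resolve_left h, fun h' => hne ?_⟩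
    rw [Set.mem_singleton_iff] at h'
    rw [← conj_conj_swap a b g, h']
    simp

lemma pull_injOn {n : ℕ} {y w : Equiv.Perm (Fin n)} {a b : Fin n} (hyw : bruhatLE y w)
    (hab : a < b) (hs : Equiv.swap a b ∈ R y w) (hn : NoneBetween y a b) :
    Set.InjOn (pull y w a b) (R (y * Equiv.swap a b) w) := by
  intro g hg g' hg' h
  unfold pull at h
  split_ifs at h with h1 h2 h2
  · exact h
  · exact absurd ((conj_mem_R hyw hab hs hn hg').2 (h ▸ hg)) h2
  · exact absurd ((conj_mem_R hyw hab hs hn hg).2 (h ▸ hg')) h1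
  · simpa using h

lemma ncard_R_mul_swap_lt {n : ℕ} {y w : Equiv.Perm (Fin n)} {a b : Fin n}
    (hyw : bruhatLE y w) (hab : a < b) (hs : Equiv.swap a b ∈ R y w)
    (hn : NoneBetween y a b) :
    (R (y * Equiv.swap a b) w).ncard + 1 ≤ (R y w).ncard := by
  have := Set.ncard_le_ncard_of_injOn _ (pull_mapsTo hyw hab hs hn) (pull_injOn hyw hab hs hn)
  have := Set.ncard_sdiff_singleton_add_one hs
  omega

lemma exists_cover {n : ℕ} {y w : Equiv.Perm (Fin n)} (hyw : bruhatLE y w) (hne : y ≠ w) :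
    ∃ a b, a < b ∧ Equiv.swap a b ∈ R y w ∧ NoneBetween y a b := by
  obtain ⟨a, haw, hamin⟩ : ∃ a, y a ≠ w a ∧ ∀ c, c < a → y c = w c := by
    have hex : ∃ a, y a ≠ w a := by
      by_contra! h
      exact hne (Equiv.ext h)
    obtain ⟨a, ha, hmin⟩ := WellFounded.has_min (wellFounded_lt (α := Fin n)) {a | y a ≠ w a} hex
    exact ⟨a, ha, fun c hc => by_contra fun h => hmin c h hc⟩
  have hfib : ∀ c, y c = w a → a < c := by
    intro c hc
    by_contra! hle
    rcases hle.lt_or_eq with h | h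
    · exact h.ne (w.injective ((hamin c h).symm.trans hc))
    · exact haw (h ▸ hc)
  have hlt : y a < w a := by
    by_contra! hle
    have hgt : w a < y a := lt_of_le_of_ne hle (Ne.symm haw)
    have := hyw ((a : ℕ) + 1) ((y a : ℕ) + 1)
    have hss : Finset.univ.filter (fun i : Fin n =>
          ((i : ℕ) : ℤ) + 1 ≤ (a : ℕ) + 1 ∧ ((y a : ℕ) : ℤ) + 1 ≤ ((w i : ℕ) : ℤ) + 1) ⊂
        Finset.univ.filter (fun i : Fin n =>
          ((i : ℕ) : ℤ) + 1 ≤ (a : ℕ) + 1 ∧ ((y a : ℕ) : ℤ) + 1 ≤ ((y i : ℕ) : ℤ) + 1) := by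
      rw [Finset.ssubset_iff_of_subset]
      · refine ⟨a, by simp, ?_⟩
        simp only [Finset.mem_filter, Finset.mem_univ, true_and]
        rw [Fin.lt_def] at hgt
        omega
      · intro i
        simp only [Finset.mem_filter, Finset.mem_univ, true_and]
        rintro ⟨h1, h2⟩
        have hia : i < a := by
          rcases lt_or_eq_of_le (show i ≤ a by rw [Fin.le_def]; omega) with h | h
          · exact h
          · subst h
            rw [Fin.lt_def] at hgt
            omega
        rw [hamin i hia]
        exact ⟨h1, h2⟩
    have := Finset.card_lt_card hss
    simp only [dxw, rank] at *
    omega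
  obtain ⟨b, ⟨hab, hyab, hybw⟩, hbmin⟩ : ∃ b, (a < b ∧ y a < y b ∧ y b ≤ w a) ∧
      ∀ c, c < b → ¬ (a < c ∧ y a < y c ∧ y c ≤ w a) := by
    obtain ⟨b, hb, hmin⟩ := WellFounded.has_min (wellFounded_lt (α := Fin n))
      {b | a < b ∧ y a < y b ∧ y b ≤ w a}
      ⟨y.symm (w a), hfib _ (by simp), by simpa using hlt, by simp⟩
    exact ⟨b, hb, fun c hc h => hmin c h hc⟩
  refine ⟨a, b, hab, (swap_mem_R_iff hyw hab).2 ⟨hyab, ?_⟩, fun c h1 h2 h3 h4 =>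
    hbmin c h2 ⟨h1, h3, h4.le.trans hybw⟩⟩
  rintro p q ⟨h1, h2, h3, h4⟩
  have h0 := hyw p ((w a : ℕ) + 2)
  have hterm : ∀ i : Fin n,
      (if ((i : ℕ) : ℤ) + 1 ≤ p ∧ q ≤ ((y i : ℕ) : ℤ) + 1 then (1 : ℤ) else 0) -
        (if ((i : ℕ) : ℤ) + 1 ≤ p ∧ ((w a : ℕ) : ℤ) + 2 ≤ ((y i : ℕ) : ℤ) + 1 then 1 else 0) +
        (if i = a then 1 else 0) ≤
      (if ((i : ℕ) : ℤ) + 1 ≤ p ∧ q ≤ ((w i : ℕ) : ℤ) + 1 then (1 : ℤ) else 0) -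
        (if ((i : ℕ) : ℤ) + 1 ≤ p ∧ ((w a : ℕ) : ℤ) + 2 ≤ ((w i : ℕ) : ℤ) + 1 then 1 else 0) := by
    intro i
    rcases lt_trichotomy i a with h | h | h
    · rw [hamin i h, if_neg h.ne]
      simp
    · subst h
      rw [Fin.lt_def] at hlt hyab
      rw [Fin.le_def] at hybw
      rw [if_pos rfl]
      split_ifs <;> omega
    · have := hbmin i
      rw [if_neg h.ne']
      simp only [Fin.lt_def, Fin.le_def] at *
      split_ifs <;> omega
  have hsum := Finset.sum_le_sum fun i (_ : i ∈ Finset.univ) => hterm i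
  simp only [Finset.sum_sub_distrib, Finset.sum_add_distrib, ← rank_eq_sum] at hsum
  simp only [dxw] at h0 ⊢
  simp at hsum
  omega

/-- Deodhar's inequality for the symmetric group. -/
lemma invLen_sub_le_ncard_R {n : ℕ} {y w : Equiv.Perm (Fin n)} (hyw : bruhatLE y w) :
    (invLen w : ℤ) - invLen y ≤ (R y w).ncard := by
  induction hN : n * n - invLen y using Nat.strong_induction_on generalizing y with
  | _ N ih =>
    by_cases hne : y = w
    · subst hne
      simp
    · obtain ⟨a, b, hab, hs, hn⟩ := exists_cover hyw hne
      have hlen := (invLen_mul_swap y hab ((swap_mem_R_iff hyw hab).1 hs).1).2 hn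
      have hbound : invLen (y * Equiv.swap a b) ≤ n * n := by
        refine (Finset.card_le_univ _).trans ?_
        simp
      have h1 := ih _ (by omega) hs.2.2 rfl
      have h2 := ncard_R_mul_swap_lt hyw hab hs hn
      omega

lemma mem_R_mul_swap_of_disjoint {n : ℕ} {y w : Equiv.Perm (Fin n)} {a b i j : Fin n}
    (hyw : bruhatLE y w) (hsmooth : ((R y w).ncard : ℤ) = (invLen w : ℤ) - invLen y)
    (hab : a < b) (hs : Equiv.swap a b ∈ R y w) (hn : NoneBetween y a b)
    (hia : i ≠ a) (hib : i ≠ b) (hja : j ≠ a) (hjb : j ≠ b) (hg : Equiv.swap i j ∈ R y w) :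
    Equiv.swap i j ∈ R (y * Equiv.swap a b) w := by
  have hlen := (invLen_mul_swap y hab ((swap_mem_R_iff hyw hab).1 hs).1).2 hn
  have h1 := invLen_sub_le_ncard_R hs.2.2
  have h2 := Set.ncard_sdiff_singleton_add_one hs
  have himg : pull y w a b '' R (y * Equiv.swap a b) w = R y w \ {Equiv.swap a b} := by
    refine Set.eq_of_subset_of_ncard_le (pull_mapsTo hyw hab hs hn).image_subset ?_
    rw [(pull_injOn hyw hab hs hn).ncard_image]
    omega
  have hne : Equiv.swap i j ≠ Equiv.swap a b := by
    intro h
    have h3 : Equiv.swap i j a = b := by rw [h, Equiv.swap_apply_left]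
    rw [Equiv.swap_apply_of_ne_of_ne hia.symm hja.symm] at h3
    exact hab.ne h3
  obtain ⟨g', hg', heq⟩ : Equiv.swap i j ∈ pull y w a b '' R (y * Equiv.swap a b) w := by
    rw [himg]
    exact ⟨hg, hne⟩
  unfold pull at heq
  split_ifs at heq with h
  · exact heq ▸ hg'
  · rw [← conj_conj_swap a b g', heq, conj_swap_disjoint hia hib hja hjb] at hg'
    exact hg'
lemma dxw_eq_card_sub_card {n : ℕ} (y w : Equiv.Perm (Fin n)) (p q : ℤ) :
    dxw y w p q =
      ((Finset.univ.filter fun i : Fin n => p ≤ ((i : ℕ) : ℤ) ∧ ((w i : ℕ) : ℤ) + 1 < q).card : ℤ) -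
        (Finset.univ.filter fun i : Fin n => p ≤ ((i : ℕ) : ℤ) ∧ ((y i : ℕ) : ℤ) + 1 < q).card := by
  have key : ∀ v : Equiv.Perm (Fin n), (rank v p q : ℤ) -
      ((Finset.univ.filter fun i : Fin n => p ≤ ((i : ℕ) : ℤ) ∧ ((v i : ℕ) : ℤ) + 1 < q).card : ℤ) =
      (∑ i : Fin n, if ((i : ℕ) : ℤ) + 1 ≤ p then (1 : ℤ) else 0) -
        ∑ i : Fin n, if ((i : ℕ) : ℤ) + 1 < q then (1 : ℤ) else 0 := by
    intro v
    rw [rank_eq_sum, ← Equiv.sum_comp v fun i : Fin n =>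
      if ((i : ℕ) : ℤ) + 1 < q then (1 : ℤ) else 0]
    rw [show ((Finset.univ.filter fun i : Fin n =>
        p ≤ ((i : ℕ) : ℤ) ∧ ((v i : ℕ) : ℤ) + 1 < q).card : ℤ) =
        ∑ i : Fin n, if p ≤ ((i : ℕ) : ℤ) ∧ ((v i : ℕ) : ℤ) + 1 < q then (1 : ℤ) else 0 by
      simp [Finset.sum_boole], ← Finset.sum_sub_distrib, ← Finset.sum_sub_distrib]
    refine Finset.sum_congr rfl fun i _ => ?_
    split_ifs <;> omega
  have h1 := key y
  have h2 := key w
  simp only [dxw]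
  linarith

lemma swap_mem_R_mul_swap_iff {n : ℕ} {y w : Equiv.Perm (Fin n)} {a b i j : Fin n}
    (hyw : bruhatLE y w) (hab : a < b) (hs : Equiv.swap a b ∈ R y w) (hij : i < j)
    (hia : i ≠ a) (hib : i ≠ b) (hja : j ≠ a) (hjb : j ≠ b) :
    Equiv.swap i j ∈ R (y * Equiv.swap a b) w ↔ y i < y j ∧ ∀ p q, InBox y i j p q →
      1 ≤ dxw y w p q - if InBox y a b p q then 1 else 0 := by
  have hd := dxw_mul_swap y w hab ((swap_mem_R_iff hyw hab).1 hs).1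
  have vi : (y * Equiv.swap a b) i = y i := by simp [Equiv.swap_apply_of_ne_of_ne hia hib]
  have vj : (y * Equiv.swap a b) j = y j := by simp [Equiv.swap_apply_of_ne_of_ne hja hjb]
  rw [swap_mem_R_iff hs.2.2 hij]
  simp only [vi, vj, InBox, hd]

lemma swap_mem_R_mul_swap_comm {n : ℕ} {y w : Equiv.Perm (Fin n)} {a b i j : Fin n}
    (hyw : bruhatLE y w) (hab : a < b) (hs : Equiv.swap a b ∈ R y w) (hij : i < j)
    (hg : Equiv.swap i j ∈ R y w) (hia : i ≠ a) (hib : i ≠ b) (hja : j ≠ a) (hjb : j ≠ b) :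
    Equiv.swap i j ∈ R (y * Equiv.swap a b) w ↔
      Equiv.swap a b ∈ R (y * Equiv.swap i j) w := by
  rw [swap_mem_R_mul_swap_iff hyw hab hs hij hia hib hja hjb,
    swap_mem_R_mul_swap_iff hyw hij hg hab hia.symm hja.symm hib.symm hjb.symm]
  obtain ⟨hv, h⟩ := (swap_mem_R_iff hyw hab).1 hs
  obtain ⟨hv', h'⟩ := (swap_mem_R_iff hyw hij).1 hg
  constructor
  · rintro ⟨-, h1⟩
    refine ⟨hv, fun p q hpq => ?_⟩
    have h2 := h1 p q
    have h3 := h p q hpq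
    rw [if_pos hpq] at h2
    split_ifs with h4
    · exact h2 h4
    · omega
  · rintro ⟨-, h1⟩
    refine ⟨hv', fun p q hpq => ?_⟩
    have h2 := h1 p q
    have h3 := h' p q hpq
    rw [if_pos hpq] at h2
    split_ifs with h4
    · exact h2 h4
    · omega

lemma apply_of_lt {k m n : ℕ} {x : Equiv.Perm (Fin n)}
    (hx : ∀ i : Fin n, (x i : ℕ) = xkmVal k m (i : ℕ)) {i : Fin n} (hi : (i : ℕ) < k) :
    (x i : ℕ) + i + 1 = k := by
  rw [hx, xkmVal, if_pos hi]
  omega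

lemma apply_of_le {k m n : ℕ} {x : Equiv.Perm (Fin n)} (hkm : k + m = n)
    (hx : ∀ i : Fin n, (x i : ℕ) = xkmVal k m (i : ℕ)) {i : Fin n} (hi : k ≤ (i : ℕ)) :
    (x i : ℕ) + i + 1 = k + n := by
  rw [hx, xkmVal, if_neg (by omega)]
  omega

lemma mem_R_xkm_iff {k m n : ℕ} {x w : Equiv.Perm (Fin n)} (hxw : bruhatLE x w)
    (hkm : k + m = n) (hx : ∀ i : Fin n, (x i : ℕ) = xkmVal k m (i : ℕ)) {i j : Fin n}
    (hij : i < j) :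
    Equiv.swap i j ∈ R x w ↔ (i : ℕ) < k ∧ k ≤ (j : ℕ) ∧ ∀ p q : ℤ,
      ((i : ℕ) : ℤ) + 1 ≤ p → p ≤ ((j : ℕ) : ℤ) → (k : ℤ) + 1 - (i : ℕ) ≤ q →
      q ≤ (k : ℤ) + n - (j : ℕ) → 1 ≤ dxw x w p q := by
  rw [swap_mem_R_iff hxw hij]
  rw [Fin.lt_def] at hij ⊢
  by_cases hi : (i : ℕ) < k
  · have vi := apply_of_lt hx hi
    by_cases hj : k ≤ (j : ℕ)
    · have vj := apply_of_le hkm hx hj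
      constructor
      · rintro ⟨-, h⟩
        exact ⟨hi, hj, fun p q h1 h2 h3 h4 => h p q ⟨h1, h2, by omega, by omega⟩⟩
      · rintro ⟨-, -, h⟩
        exact ⟨by omega, fun p q hpq =>
          h p q hpq.1 hpq.2.1 (by have := hpq.2.2.1; omega) (by have := hpq.2.2.2; omega)⟩
    · have vj := apply_of_lt hx (not_le.1 hj)
      exact ⟨fun h => by omega, fun h => by omega⟩
  · have vi := apply_of_le hkm hx (not_lt.1 hi)
    have vj := apply_of_le hkm hx ((not_lt.1 hi).trans hij.le)
    exact ⟨fun h => by omega, fun h => by omega⟩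

lemma exists_right_partner {k m n : ℕ} {x w : Equiv.Perm (Fin n)} (hxw : bruhatLE x w)
    (hkm : k + m = n) (hx : ∀ i : Fin n, (x i : ℕ) = xkmVal k m (i : ℕ))
    (hdelta : Delta x w = Set.univ) {i : Fin n} (hi : (i : ℕ) < k) :
    ∃ j, i < j ∧ Equiv.swap i j ∈ R x w := by
  obtain ⟨j, hj⟩ : i ∈ Delta x w := hdelta ▸ Set.mem_univ i
  rcases lt_trichotomy i j with h | h | h
  · exact ⟨j, h, hj⟩
  · subst h
    have hlt := hj.2.1
    rw [Equiv.swap_self, ← Equiv.Perm.one_def, mul_one] at hlt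
    exact absurd hlt (lt_irrefl _)
  · rw [Equiv.swap_comm] at hj
    have := (mem_R_xkm_iff hxw hkm hx h).1 hj
    omega

lemma exists_left_partner {k m n : ℕ} {x w : Equiv.Perm (Fin n)} (hxw : bruhatLE x w)
    (hkm : k + m = n) (hx : ∀ i : Fin n, (x i : ℕ) = xkmVal k m (i : ℕ))
    (hdelta : Delta x w = Set.univ) {j : Fin n} (hj : k ≤ (j : ℕ)) :
    ∃ i, i < j ∧ Equiv.swap i j ∈ R x w := by
  obtain ⟨i, hi⟩ : j ∈ Delta x w := hdelta ▸ Set.mem_univ j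
  rcases lt_trichotomy i j with h | h | h
  · exact ⟨i, h, Equiv.swap_comm j i ▸ hi⟩
  · subst h
    have hlt := hi.2.1
    rw [Equiv.swap_self, ← Equiv.Perm.one_def, mul_one] at hlt
    exact absurd hlt (lt_irrefl _)
  · have := (mem_R_xkm_iff hxw hkm hx h).1 hi
    omega

lemma le_apply_add {k m n : ℕ} {x w : Equiv.Perm (Fin n)} (hxw : bruhatLE x w)
    (hkm : k + m = n) (hx : ∀ i : Fin n, (x i : ℕ) = xkmVal k m (i : ℕ))
    (hdelta : Delta x w = Set.univ) {i : Fin n} (hi : (i : ℕ) < k) : k ≤ (w i : ℕ) + i := by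
  obtain ⟨j, hij, hR⟩ := exists_right_partner hxw hkm hx hdelta hi
  obtain ⟨-, hj, h⟩ := (mem_R_xkm_iff hxw hkm hx hij).1 hR
  have hd := h ((i : ℕ) + 1) (k + 1 - (i : ℕ)) le_rfl (by omega) le_rfl (by omega)
  by_contra! hlt
  have hsub : Finset.univ.filter (fun c : Fin n => ((c : ℕ) : ℤ) + 1 ≤ (i : ℕ) + 1 ∧
        (k : ℤ) + 1 - (i : ℕ) ≤ ((w c : ℕ) : ℤ) + 1) ⊆
      Finset.univ.filter (fun c : Fin n => ((c : ℕ) : ℤ) + 1 ≤ (i : ℕ) + 1 ∧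
        (k : ℤ) + 1 - (i : ℕ) ≤ ((x c : ℕ) : ℤ) + 1) := by
    intro c
    simp only [Finset.mem_filter, Finset.mem_univ, true_and]
    rintro ⟨h1, h2⟩
    have hne : (c : ℕ) ≠ i := by
      intro hc
      rw [Fin.ext hc] at h2
      omega
    have := apply_of_lt hx (show (c : ℕ) < k by omega)
    omega
  have := Finset.card_le_card hsub
  simp only [dxw, rank] at hd
  omega

lemma add_apply_lt {k m n : ℕ} {x w : Equiv.Perm (Fin n)} (hxw : bruhatLE x w)
    (hkm : k + m = n) (hx : ∀ i : Fin n, (x i : ℕ) = xkmVal k m (i : ℕ))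
    (hdelta : Delta x w = Set.univ) {c : Fin n} (hc : k ≤ (w c : ℕ)) :
    (c : ℕ) + w c + 1 < k + n := by
  by_contra! hge
  let j : Fin n := ⟨k + n - 1 - w c, by omega⟩
  have hjv : (j : ℕ) = k + n - 1 - w c := rfl
  have hwc := (w c).isLt
  have hj : k ≤ (j : ℕ) := by omega
  have hjc : (j : ℕ) ≤ c := by omega
  obtain ⟨i, hij, hR⟩ := exists_left_partner hxw hkm hx hdelta hj
  obtain ⟨hi, -, h⟩ := (mem_R_xkm_iff hxw hkm hx hij).1 hR
  have hd := h (j : ℕ) (k + n - (j : ℕ)) (by omega) le_rfl (by omega) le_rfl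
  rw [dxw_eq_card_sub_card] at hd
  have hsub1 : Finset.univ.filter (fun e : Fin n => ((j : ℕ) : ℤ) ≤ ((e : ℕ) : ℤ) ∧
      ((w e : ℕ) : ℤ) + 1 < (k : ℤ) + n - (j : ℕ)) ⊆ (Finset.Ici j).erase c := by
    intro e
    simp only [Finset.mem_filter, Finset.mem_univ, true_and, Finset.mem_erase, Finset.mem_Ici]
    rintro ⟨h1, h2⟩
    refine ⟨?_, by rw [Fin.le_def]; omega⟩
    rintro rfl
    omega
  have hsub2 : (Finset.Ici j).erase j ⊆ Finset.univ.filter (fun e : Fin n =>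
      ((j : ℕ) : ℤ) ≤ ((e : ℕ) : ℤ) ∧ ((x e : ℕ) : ℤ) + 1 < (k : ℤ) + n - (j : ℕ)) := by
    intro e
    simp only [Finset.mem_filter, Finset.mem_univ, true_and, Finset.mem_erase, Finset.mem_Ici,
      ne_eq, Fin.ext_iff, Fin.le_def]
    rintro ⟨h1, h2⟩
    have := apply_of_le hkm hx (hj.trans h2)
    omega
  have h1 := Finset.card_le_card hsub1
  have h2 := Finset.card_le_card hsub2
  rw [Finset.card_erase_of_mem (by rw [Finset.mem_Ici, Fin.le_def]; exact hjc)] at h1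
  rw [Finset.card_erase_of_mem (by simp)] at h2
  omega

/-- The transposition of the two positions around the descent break of `x`. -/
lemma inner_swap_mem_R {k m n : ℕ} {x w : Equiv.Perm (Fin n)} (hxw : bruhatLE x w)
    (hkm : k + m = n) (hx : ∀ i : Fin n, (x i : ℕ) = xkmVal k m (i : ℕ))
    (hdelta : Delta x w = Set.univ) {a b : Fin n} (ha : (a : ℕ) + 1 = k) (hb : (b : ℕ) = k) :
    Equiv.swap a b ∈ R x w := by
  have hab : a < b := by rw [Fin.lt_def]; omega
  obtain ⟨j, haj, hj⟩ := exists_right_partner hxw hkm hx hdelta (show (a : ℕ) < k by omega)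
  obtain ⟨i, hib, hi⟩ := exists_left_partner hxw hkm hx hdelta hb.ge
  obtain ⟨-, -, hj⟩ := (mem_R_xkm_iff hxw hkm hx haj).1 hj
  obtain ⟨-, -, hi⟩ := (mem_R_xkm_iff hxw hkm hx hib).1 hi
  rw [Fin.lt_def] at haj hib
  refine (mem_R_xkm_iff hxw hkm hx hab).2 ⟨by omega, hb.ge, fun p q h1 h2 h3 h4 => ?_⟩
  by_cases hq : q ≤ k + 1
  · exact hj p q h1 (by omega) h3 (by omega)
  · exact hi p q (by omega) h2 (by omega) h4

lemma outer_swap_mem_R {k m n : ℕ} {x w : Equiv.Perm (Fin n)} (hxw : bruhatLE x w)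
    (hkm : k + m = n) (hx : ∀ i : Fin n, (x i : ℕ) = xkmVal k m (i : ℕ))
    (hdelta : Delta x w = Set.univ) (hk : 1 ≤ k) (hm : 1 ≤ m) {a b : Fin n} (ha : (a : ℕ) = 0)
    (hb : (b : ℕ) + 1 = n) : Equiv.swap a b ∈ R x w := by
  have hab : a < b := by rw [Fin.lt_def]; omega
  obtain ⟨j, haj, hj⟩ := exists_right_partner hxw hkm hx hdelta (show (a : ℕ) < k by omega)
  obtain ⟨i, hib, hi⟩ := exists_left_partner hxw hkm hx hdelta (show k ≤ (b : ℕ) by omega)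
  obtain ⟨-, hkj, hj⟩ := (mem_R_xkm_iff hxw hkm hx haj).1 hj
  obtain ⟨hik, -, hi⟩ := (mem_R_xkm_iff hxw hkm hx hib).1 hi
  refine (mem_R_xkm_iff hxw hkm hx hab).2 ⟨by omega, by omega, fun p q h1 h2 h3 h4 => ?_⟩
  by_cases hp : p ≤ k
  · exact hj p q h1 (by omega) h3 (by omega)
  · exact hi p q (by omega) h2 (by omega) h4

lemma exists_conflict {k m n : ℕ} {x w : Equiv.Perm (Fin n)} (hmsp : MSP x w)
    (hkm : k + m = n) (hx : ∀ i : Fin n, (x i : ℕ) = xkmVal k m (i : ℕ))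
    {a b : Fin n} (ha : (a : ℕ) + 1 = k) (hb : (b : ℕ) = k) (ht : Equiv.swap a b ∈ R x w) :
    ∃ i j : Fin n, (i : ℕ) + 1 < k ∧ k < (j : ℕ) ∧ Equiv.swap i j ∈ R x w ∧
      Equiv.swap i j ∉ R (x * Equiv.swap a b) w := by
  obtain ⟨hxw, hsing, hsmooth⟩ := hmsp
  by_contra! hall
  have hab : a < b := by rw [Fin.lt_def]; omega
  obtain ⟨hv, hbox⟩ := (swap_mem_R_iff hxw hab).1 ht
  have hd := dxw_mul_swap x w hab hv
  have va : (x * Equiv.swap a b) a = x b := by simp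
  have vb : (x * Equiv.swap a b) b = x a := by simp
  have xa := apply_of_lt hx (show (a : ℕ) < k by omega)
  have xb := apply_of_le hkm hx hb.ge
  have hmaps : Set.MapsTo (fun g => Equiv.swap a b * g * Equiv.swap a b)
      (R x w \ {Equiv.swap a b}) (R (x * Equiv.swap a b) w) := by
    rintro g ⟨hg, hne⟩
    rcases transposition_cases (a := a) (b := b) hg.1 with
      ⟨i, j, hij, hia, hib, hja, hjb, rfl⟩ | ⟨c, hca, hcb, rfl | rfl⟩ | rfl
    · simp only [conj_swap_disjoint hia hib hja hjb]
      wlog hlt : i < j generalizing i j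
      · rw [Equiv.swap_comm i j] at hg hne ⊢
        exact this j i hij.symm hja hjb hia hib hg hne
          (lt_of_le_of_ne (not_lt.1 hlt) hij.symm)
      obtain ⟨hi, hj, -⟩ := (mem_R_xkm_iff hxw hkm hx hlt).1 hg
      simp only [ne_eq, Fin.ext_iff] at hia hjb
      exact hall i j (by omega) (by omega) hg
    · simp only [conj_swap_left hca hcb]
      have hac : a < c := by
        by_contra! h
        have := (mem_R_xkm_iff hxw hkm hx (lt_of_le_of_ne h hca)).1 hg
        omega
      rw [Equiv.swap_comm c a] at hg
      rw [Equiv.swap_comm c b]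
      obtain ⟨-, hkc, -⟩ := (mem_R_xkm_iff hxw hkm hx hac).1 hg
      have hbc : b < c := by
        simp only [ne_eq, Fin.ext_iff] at hcb
        rw [Fin.lt_def]
        omega
      have vc : (x * Equiv.swap a b) c = x c := by simp [Equiv.swap_apply_of_ne_of_ne hca hcb]
      obtain ⟨hv', hbox'⟩ := (swap_mem_R_iff hxw hac).1 hg
      rw [swap_mem_R_iff ht.2.2 hbc, vb, vc]
      refine ⟨hv', fun p q hpq => ?_⟩
      simp only [InBox, vb, vc] at hpq hbox'
      rw [hd, if_neg (by simp only [InBox]; omega), sub_zero]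
      exact hbox' p q (by omega)
    · simp only [conj_swap_right hca hcb]
      have hcb' : c < b := by
        by_contra! h
        rw [Equiv.swap_comm] at hg
        have := (mem_R_xkm_iff hxw hkm hx (lt_of_le_of_ne h hcb.symm)).1 hg
        omega
      obtain ⟨hck, -, -⟩ := (mem_R_xkm_iff hxw hkm hx hcb').1 hg
      have hca' : c < a := by
        simp only [ne_eq, Fin.ext_iff] at hca
        rw [Fin.lt_def]
        omega
      have vc : (x * Equiv.swap a b) c = x c := by simp [Equiv.swap_apply_of_ne_of_ne hca hcb]
      obtain ⟨hv', hbox'⟩ := (swap_mem_R_iff hxw hcb').1 hg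
      rw [swap_mem_R_iff ht.2.2 hca', va, vc]
      refine ⟨hv', fun p q hpq => ?_⟩
      simp only [InBox, va, vc] at hpq hbox'
      rw [hd, if_neg (by simp only [InBox]; omega), sub_zero]
      exact hbox' p q (by omega)
    · exact absurd rfl hne
  have hinj : Function.Injective (fun g => Equiv.swap a b * g * Equiv.swap a b) :=
    fun g g' h => by simpa using h
  have h1 := Set.ncard_le_ncard_of_injOn _ hmaps hinj.injOn
  have h2 := Set.ncard_sdiff_singleton_add_one ht
  have h3 := hsmooth _ ht
  have h4 := (invLen_mul_swap x hab hv).1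
  omega
lemma not_mem_of_move_right {k m n : ℕ} {x w : Equiv.Perm (Fin n)} (hmsp : MSP x w)
    (hkm : k + m = n) (hx : ∀ i : Fin n, (x i : ℕ) = xkmVal k m (i : ℕ)) {a b i j j' : Fin n}
    (hab : a < b) (ht : Equiv.swap a b ∈ R x w) (hij : i < j) (hjj : j < j')
    (hia : i ≠ a) (hib : i ≠ b) (hja : j ≠ a) (hjb : j ≠ b) (hja' : j' ≠ a) (hjb' : j' ≠ b)
    (hf : Equiv.swap i j ∈ R x w) (hf' : Equiv.swap i j' ∈ R x w)
    (hconf : Equiv.swap i j ∉ R (x * Equiv.swap a b) w) :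
    Equiv.swap i j' ∉ R (x * Equiv.swap a b) w := by
  intro hmem
  apply hconf
  have hxw := hmsp.1
  have hij' := hij.trans hjj
  rw [swap_mem_R_mul_swap_comm hxw hab ht hij' hf' hia hib hja' hjb'] at hmem
  rw [swap_mem_R_mul_swap_comm hxw hab ht hij hf hia hib hja hjb]
  obtain ⟨hi, hj, -⟩ := (mem_R_xkm_iff hxw hkm hx hij).1 hf
  obtain ⟨hv, hbox⟩ := (swap_mem_R_iff hxw hij).1 hf
  obtain ⟨hv', hbox'⟩ := (swap_mem_R_iff hxw hij').1 hf'
  have xi := apply_of_lt hx hi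
  have xj := apply_of_le hkm hx hj
  have xj' := apply_of_le hkm hx (hj.trans hjj.le)
  have vi : (x * Equiv.swap i j') i = x j' := by simp
  have vj : (x * Equiv.swap i j') j = x j := by
    simp [Equiv.swap_apply_of_ne_of_ne hij.ne' hjj.ne]
  have va : (x * Equiv.swap i j') a = x a := by
    simp [Equiv.swap_apply_of_ne_of_ne hia.symm hja'.symm]
  have vb : (x * Equiv.swap i j') b = x b := by
    simp [Equiv.swap_apply_of_ne_of_ne hib.symm hjb'.symm]
  have hd := dxw_mul_swap x w hij' hv'
  rw [Fin.lt_def] at hij hjj hij' hv hv'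
  have hs : Equiv.swap i j ∈ R (x * Equiv.swap i j') w := by
    rw [swap_mem_R_iff hf'.2.2 (by exact hij), vi, vj]
    refine ⟨by rw [Fin.lt_def]; omega, fun p q hpq => ?_⟩
    simp only [InBox, vi, vj] at hpq hbox
    rw [hd, if_neg (by simp only [InBox]; omega), sub_zero]
    exact hbox p q (by omega)
  have hn : NoneBetween (x * Equiv.swap i j') i j := by
    intro c h1 h2 h3 h4
    have vc : (x * Equiv.swap i j') c = x c := by
      rw [Equiv.Perm.mul_apply, Equiv.swap_apply_of_ne_of_ne h1.ne']
      exact (h2.trans hjj).ne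
    rw [vi, vc] at h3
    rw [vj, vc] at h4
    rw [Fin.lt_def] at h1 h2 h3 h4
    by_cases hck : (c : ℕ) < k
    · have := apply_of_lt hx hck
      omega
    · have := apply_of_le hkm hx (not_lt.1 hck)
      omega
  have hz := mem_R_mul_swap_of_disjoint hf'.2.2 (hmsp.2.2 _ hf') (by exact hij) hs hn
    hia.symm hja.symm hib.symm hjb.symm hmem
  rw [swap_mem_R_iff hs.2.2 hab] at hz
  rw [swap_mem_R_mul_swap_iff hxw (by exact hij) hf hab hia.symm hja.symm hib.symm hjb.symm]
  have ua : (x * Equiv.swap i j' * Equiv.swap i j) a = x a := by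
    rw [Equiv.Perm.mul_apply, Equiv.swap_apply_of_ne_of_ne hia.symm hja.symm, va]
  have ub : (x * Equiv.swap i j' * Equiv.swap i j) b = x b := by
    rw [Equiv.Perm.mul_apply, Equiv.swap_apply_of_ne_of_ne hib.symm hjb.symm, vb]
  rw [ua, ub] at hz
  refine ⟨hz.1, fun p q hpq => ?_⟩
  have h1 := hz.2 p q (by simp only [InBox, ua, ub]; exact hpq)
  rw [dxw_mul_swap _ w (by exact hij) ((swap_mem_R_iff hf'.2.2 (by exact hij)).1 hs).1, hd] at h1
  simp only [InBox, vi, vj] at h1 ⊢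
  split_ifs at h1 ⊢ <;> omega

lemma not_mem_of_move_left {k m n : ℕ} {x w : Equiv.Perm (Fin n)} (hmsp : MSP x w)
    (hkm : k + m = n) (hx : ∀ i : Fin n, (x i : ℕ) = xkmVal k m (i : ℕ)) {a b i i' j : Fin n}
    (hab : a < b) (ht : Equiv.swap a b ∈ R x w) (hij : i < j) (hii : i' < i)
    (hia : i ≠ a) (hib : i ≠ b) (hja : j ≠ a) (hjb : j ≠ b) (hia' : i' ≠ a) (hib' : i' ≠ b)
    (hf : Equiv.swap i j ∈ R x w) (hf' : Equiv.swap i' j ∈ R x w)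
    (hconf : Equiv.swap i j ∉ R (x * Equiv.swap a b) w) :
    Equiv.swap i' j ∉ R (x * Equiv.swap a b) w := by
  intro hmem
  apply hconf
  have hxw := hmsp.1
  have hij' := hii.trans hij
  rw [swap_mem_R_mul_swap_comm hxw hab ht hij' hf' hia' hib' hja hjb] at hmem
  rw [swap_mem_R_mul_swap_comm hxw hab ht hij hf hia hib hja hjb]
  obtain ⟨hi, hj, -⟩ := (mem_R_xkm_iff hxw hkm hx hij).1 hf
  obtain ⟨hv, hbox⟩ := (swap_mem_R_iff hxw hij).1 hf
  obtain ⟨hv', hbox'⟩ := (swap_mem_R_iff hxw hij').1 hf'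
  have xi := apply_of_lt hx hi
  have xi' := apply_of_lt hx (show (i' : ℕ) < k from lt_trans hii hi)
  have xj := apply_of_le hkm hx hj
  have vi : (x * Equiv.swap i' j) i = x i := by
    simp [Equiv.swap_apply_of_ne_of_ne hii.ne' hij.ne]
  have vj : (x * Equiv.swap i' j) j = x i' := by simp
  have va : (x * Equiv.swap i' j) a = x a := by
    simp [Equiv.swap_apply_of_ne_of_ne hia'.symm hja.symm]
  have vb : (x * Equiv.swap i' j) b = x b := by
    simp [Equiv.swap_apply_of_ne_of_ne hib'.symm hjb.symm]
  have hd := dxw_mul_swap x w hij' hv'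
  rw [Fin.lt_def] at hij hii hij' hv hv'
  have hs : Equiv.swap i j ∈ R (x * Equiv.swap i' j) w := by
    rw [swap_mem_R_iff hf'.2.2 (by exact hij), vi, vj]
    refine ⟨by rw [Fin.lt_def]; omega, fun p q hpq => ?_⟩
    simp only [InBox, vi, vj] at hpq hbox
    rw [hd, if_neg (by simp only [InBox]; omega), sub_zero]
    exact hbox p q (by omega)
  have hn : NoneBetween (x * Equiv.swap i' j) i j := by
    intro c h1 h2 h3 h4
    have vc : (x * Equiv.swap i' j) c = x c := by
      rw [Equiv.Perm.mul_apply, Equiv.swap_apply_of_ne_of_ne _ h2.ne]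
      rw [ne_eq, Fin.ext_iff]
      rw [Fin.lt_def] at h1
      omega
    rw [vi, vc] at h3
    rw [vj, vc] at h4
    rw [Fin.lt_def] at h1 h2 h3 h4
    by_cases hck : (c : ℕ) < k
    · have := apply_of_lt hx hck
      omega
    · have := apply_of_le hkm hx (not_lt.1 hck)
      omega
  have hz := mem_R_mul_swap_of_disjoint hf'.2.2 (hmsp.2.2 _ hf') (by exact hij) hs hn
    hia.symm hja.symm hib.symm hjb.symm hmem
  rw [swap_mem_R_iff hs.2.2 hab] at hz
  rw [swap_mem_R_mul_swap_iff hxw (by exact hij) hf hab hia.symm hja.symm hib.symm hjb.symm]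
  have ua : (x * Equiv.swap i' j * Equiv.swap i j) a = x a := by
    rw [Equiv.Perm.mul_apply, Equiv.swap_apply_of_ne_of_ne hia.symm hja.symm, va]
  have ub : (x * Equiv.swap i' j * Equiv.swap i j) b = x b := by
    rw [Equiv.Perm.mul_apply, Equiv.swap_apply_of_ne_of_ne hib.symm hjb.symm, vb]
  rw [ua, ub] at hz
  refine ⟨hz.1, fun p q hpq => ?_⟩
  have h1 := hz.2 p q (by simp only [InBox, ua, ub]; exact hpq)
  rw [dxw_mul_swap _ w (by exact hij) ((swap_mem_R_iff hf'.2.2 (by exact hij)).1 hs).1, hd] at h1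
  simp only [InBox, vi, vj] at h1 ⊢
  split_ifs at h1 ⊢ <;> omega

lemma apply_lt_of_notMem {k m n : ℕ} {x w : Equiv.Perm (Fin n)} (hxw : bruhatLE x w)
    (hkm : k + m = n) (hx : ∀ i : Fin n, (x i : ℕ) = xkmVal k m (i : ℕ))
    (hdelta : Delta x w = Set.univ) {i i' j : Fin n} (hi : (i' : ℕ) + 1 = i) (hij : i < j)
    (hf : Equiv.swap i j ∈ R x w) (hf' : Equiv.swap i' j ∉ R x w) :
    ∀ c : Fin n, c < i → (w c : ℕ) + j + 1 < k + n := by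
  obtain ⟨hik, hj, hbox⟩ := (mem_R_xkm_iff hxw hkm hx hij).1 hf
  have hij' : i' < j := by rw [Fin.lt_def] at *; omega
  rw [mem_R_xkm_iff hxw hkm hx hij'] at hf'
  push Not at hf'
  obtain ⟨p, q, h1, h2, h3, h4, h5⟩ := hf' (by omega) hj
  have hp : p = (i : ℕ) := by
    by_contra hne
    have := hbox p q (by omega) h2 (by omega) h4
    omega
  have hq : (k : ℤ) + 1 < q := by
    by_contra! hle
    obtain ⟨e, he, hR⟩ := exists_right_partner hxw hkm hx hdelta (show (i' : ℕ) < k by omega)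
    obtain ⟨-, hke, h⟩ := (mem_R_xkm_iff hxw hkm hx he).1 hR
    have := h p q h1 (by omega) h3 (by omega)
    omega
  have hempty : rank w p q = 0 := by
    have hx0 : rank x p q = 0 := by
      rw [rank, Finset.card_eq_zero, Finset.filter_eq_empty_iff]
      rintro c -
      intro hc
      have := apply_of_lt hx (show (c : ℕ) < k by omega)
      omega
    simp only [dxw] at h5
    omega
  rw [rank, Finset.card_eq_zero, Finset.filter_eq_empty_iff] at hempty
  intro c hc
  have := hempty (Finset.mem_univ c)
  rw [Fin.lt_def] at hc
  omega

lemma le_of_notMem {k m n : ℕ} {x w : Equiv.Perm (Fin n)} (hxw : bruhatLE x w)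
    (hkm : k + m = n) (hx : ∀ i : Fin n, (x i : ℕ) = xkmVal k m (i : ℕ))
    (hdelta : Delta x w = Set.univ) {i j j' : Fin n} (hj : (j : ℕ) + 1 = j') (hij : i < j)
    (hf : Equiv.swap i j ∈ R x w) (hf' : Equiv.swap i j' ∉ R x w) :
    ∀ c : Fin n, j < c → k ≤ (w c : ℕ) + i := by
  obtain ⟨hik, hkj, hbox⟩ := (mem_R_xkm_iff hxw hkm hx hij).1 hf
  have hij' : i < j' := by rw [Fin.lt_def] at *; omega
  rw [mem_R_xkm_iff hxw hkm hx hij'] at hf'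
  push Not at hf'
  obtain ⟨p, q, h1, h2, h3, h4, h5⟩ := hf' hik (by omega)
  have hp : p = (j' : ℕ) := by
    by_contra hne
    have := hbox p q h1 (by omega) h3 (by omega)
    omega
  have hq : q ≤ k := by
    by_contra! hle
    obtain ⟨e, he, hR⟩ := exists_left_partner hxw hkm hx hdelta (show k ≤ (j' : ℕ) by omega)
    obtain ⟨hke, -, h⟩ := (mem_R_xkm_iff hxw hkm hx he).1 hR
    rw [Fin.lt_def] at he
    have := h p q (by omega) h2 (by omega) h4
    omega
  have hempty : Finset.univ.filter (fun c : Fin n =>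
      p ≤ ((c : ℕ) : ℤ) ∧ ((w c : ℕ) : ℤ) + 1 < q) = ∅ := by
    have hx0 : Finset.univ.filter (fun c : Fin n =>
        p ≤ ((c : ℕ) : ℤ) ∧ ((x c : ℕ) : ℤ) + 1 < q) = ∅ := by
      rw [Finset.filter_eq_empty_iff]
      rintro c -
      intro hc
      have := apply_of_le hkm hx (show k ≤ (c : ℕ) by omega)
      omega
    rw [dxw_eq_card_sub_card, hx0, Finset.card_empty] at h5
    rw [← Finset.card_eq_zero]
    omega
  rw [Finset.filter_eq_empty_iff] at hempty
  intro c hc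
  have := hempty (Finset.mem_univ c)
  rw [Fin.lt_def] at hc
  omega

lemma two_le_card_filter {n : ℕ} {P : Fin n → Prop} [DecidablePred P] {c e : Fin n}
    (hne : c ≠ e) (hc : P c) (he : P e) : 2 ≤ (Finset.univ.filter P).card := by
  rw [← Finset.card_pair hne]
  refine Finset.card_le_card fun z hz => ?_
  rw [Finset.mem_insert, Finset.mem_singleton] at hz
  rcases hz with rfl | rfl <;> simpa

/-- If a transposition of `R(x,w)` cannot be enlarged on either side, then `d_{x,w} ≥ 2` on the
middle row of its box. -/
lemma two_le_dxw_of_stuck {k m n : ℕ} {x w : Equiv.Perm (Fin n)} (hxw : bruhatLE x w)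
    (hkm : k + m = n) (hx : ∀ i : Fin n, (x i : ℕ) = xkmVal k m (i : ℕ))
    (hdelta : Delta x w = Set.univ) {i j : Fin n} (hik : (i : ℕ) < k) (hkj : k ≤ (j : ℕ))
    (hi0 : 0 < (i : ℕ)) (hjn : (j : ℕ) + 1 < n)
    (hhigh : ∀ c : Fin n, c < i → (w c : ℕ) + j + 1 < k + n)
    (hlow : ∀ c : Fin n, j < c → k ≤ (w c : ℕ) + i) {p : ℤ} (hp1 : ((i : ℕ) : ℤ) + 1 ≤ p)
    (hp2 : p ≤ (j : ℕ)) : 2 ≤ dxw x w p (k + 1) := by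
  have hcov1 := fun c : Fin n => le_apply_add hxw hkm hx hdelta (i := c)
  have hcov2 := fun c : Fin n => add_apply_lt hxw hkm hx hdelta (c := c)
  have hxW : ∀ c : Fin n, (x c : ℕ) + i < k ∨ k + n ≤ (x c : ℕ) + j + 1 ↔ i ≤ c ∧ c ≤ j := by
    intro c
    simp only [Fin.le_def]
    by_cases hck : (c : ℕ) < k
    · have := apply_of_lt hx hck
      omega
    · have := apply_of_le hkm hx (not_lt.1 hck)
      omega
  have hmaps : (Finset.Icc i j).image (fun c => w.symm (x c)) = Finset.Icc i j := by
    refine Finset.eq_of_subset_of_card_le (fun e he => ?_) ?_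
    · obtain ⟨c, hc, rfl⟩ := Finset.mem_image.1 he
      have hval := (hxW c).2 (Finset.mem_Icc.1 hc)
      set e := w.symm (x c) with hedef
      have hwe : w e = x c := by simp [hedef]
      rw [← hwe] at hval
      have h1 := hcov1 e
      have h2 := hcov2 e
      have h3 := hhigh e
      have h4 := hlow e
      simp only [Finset.mem_Icc, Fin.le_def, Fin.lt_def] at *
      omega
    · rw [Finset.card_image_of_injective _ (show Function.Injective (fun c => w.symm (x c)) from
        w.symm.injective.comp x.injective)]
  have hw : ∀ e, i ≤ e → e ≤ j → (w e : ℕ) + i < k ∨ k + n ≤ (w e : ℕ) + j + 1 := by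
    intro e h1 h2
    have he : e ∈ (Finset.Icc i j).image (fun c => w.symm (x c)) := by
      rw [hmaps]
      exact Finset.mem_Icc.2 ⟨h1, h2⟩
    obtain ⟨c, hc, rfl⟩ := Finset.mem_image.1 he
    rw [Equiv.apply_symm_apply]
    exact (hxW c).2 (Finset.mem_Icc.1 hc)
  have hij : i ≤ j := by rw [Fin.le_def]; omega
  by_cases hpk : p ≤ k
  · have hx0 : rank x p (k + 1) = 0 := by
      rw [rank, Finset.card_eq_zero, Finset.filter_eq_empty_iff]
      rintro c - hc
      have := apply_of_lt hx (show (c : ℕ) < k by omega)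
      omega
    let z : Fin n := ⟨0, by omega⟩
    have hz : (z : ℕ) = 0 := rfl
    have h1 := hcov1 z (by omega)
    have h2 := hw i le_rfl hij
    have h3 := hcov1 i hik
    have h4 : 2 ≤ rank w p (k + 1) := by
      rw [rank]
      refine two_le_card_filter (c := z) (e := i) ?_ ⟨?_, ?_⟩ ⟨?_, ?_⟩
      · rw [ne_eq, Fin.ext_iff]
        omega
      all_goals omega
    rw [dxw, hx0]
    omega
  · have hx0 : Finset.univ.filter (fun c : Fin n =>
        p ≤ ((c : ℕ) : ℤ) ∧ ((x c : ℕ) : ℤ) + 1 < k + 1) = ∅ := by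
      rw [Finset.filter_eq_empty_iff]
      rintro c - hc
      have := apply_of_le hkm hx (show k ≤ (c : ℕ) by omega)
      omega
    let z : Fin n := ⟨n - 1, by omega⟩
    have hz : (z : ℕ) = n - 1 := rfl
    have h1 := hcov2 z
    have h2 := hw j hij le_rfl
    have h3 := hcov2 j
    have h4 : 2 ≤ (Finset.univ.filter (fun c : Fin n =>
        p ≤ ((c : ℕ) : ℤ) ∧ ((w c : ℕ) : ℤ) + 1 < k + 1)).card := by
      refine two_le_card_filter (c := z) (e := j) ?_ ⟨?_, ?_⟩ ⟨?_, ?_⟩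
      · rw [ne_eq, Fin.ext_iff]
        omega
      all_goals omega
    rw [dxw_eq_card_sub_card, hx0, Finset.card_empty]
    omega
lemma dxw_middle_le_one {k m n : ℕ} {x w : Equiv.Perm (Fin n)} (hmsp : MSP x w)
    (hkm : k + m = n) (hx : ∀ i : Fin n, (x i : ℕ) = xkmVal k m (i : ℕ))
    (hdelta : Delta x w = Set.univ) (hk : 2 ≤ k) (hm : 2 ≤ m) : dxw x w k (k + 1) ≤ 1 := by
  have hxw := hmsp.1
  by_contra! hd2
  obtain ⟨a, ha⟩ : ∃ a : Fin n, (a : ℕ) + 1 = k := ⟨⟨k - 1, by omega⟩, by simp; omega⟩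
  obtain ⟨b, hb⟩ : ∃ b : Fin n, (b : ℕ) = k := ⟨⟨k, by omega⟩, rfl⟩
  obtain ⟨z, hz⟩ : ∃ z : Fin n, (z : ℕ) = 0 := ⟨⟨0, by omega⟩, rfl⟩
  obtain ⟨e, he⟩ : ∃ e : Fin n, (e : ℕ) + 1 = n := ⟨⟨n - 1, by omega⟩, by simp; omega⟩
  have hab : a < b := by rw [Fin.lt_def]; omega
  have hze : z < e := by rw [Fin.lt_def]; omega
  have ht := inner_swap_mem_R hxw hkm hx hdelta ha hb
  have hs := outer_swap_mem_R hxw hkm hx hdelta (by omega) (by omega) hz he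
  have hne : ∀ c d : Fin n, (c : ℕ) ≠ d → c ≠ d := fun c d h => by rwa [ne_eq, Fin.ext_iff]
  obtain ⟨hvt, hboxt⟩ := (swap_mem_R_iff hxw hab).1 ht
  obtain ⟨hvs, hboxs⟩ := (swap_mem_R_iff hxw hze).1 hs
  have xa := apply_of_lt hx (show (a : ℕ) < k by omega)
  have xb := apply_of_le hkm hx hb.ge
  have xz := apply_of_lt hx (show (z : ℕ) < k by omega)
  have xe := apply_of_le hkm hx (show k ≤ (e : ℕ) by omega)
  have hsx : Equiv.swap z e ∈ R (x * Equiv.swap a b) w := by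
    rw [swap_mem_R_mul_swap_iff hxw hab ht hze (hne _ _ (by omega)) (hne _ _ (by omega))
      (hne _ _ (by omega)) (hne _ _ (by omega))]
    refine ⟨hvs, fun p q hpq => ?_⟩
    have h1 := hboxs p q hpq
    split_ifs with hin
    · simp only [InBox] at hpq hin
      obtain ⟨rfl, rfl⟩ : p = k ∧ q = k + 1 := by omega
      omega
    · omega
  have hts : Equiv.swap a b ∈ R (x * Equiv.swap z e) w :=
    (swap_mem_R_mul_swap_comm hxw hab ht hze hs (hne _ _ (by omega)) (hne _ _ (by omega))
      (hne _ _ (by omega)) (hne _ _ (by omega))).1 hsx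
  let C : Finset (Fin n × Fin n) := Finset.univ.filter fun c => (c.1 : ℕ) + 1 < k ∧
    k < (c.2 : ℕ) ∧ Equiv.swap c.1 c.2 ∈ R x w ∧
      Equiv.swap c.1 c.2 ∉ R (x * Equiv.swap a b) w
  have hCne : C.Nonempty := by
    obtain ⟨i, j, h⟩ := exists_conflict hmsp hkm hx ha hb ht
    exact ⟨(i, j), by simpa [C] using h⟩
  obtain ⟨⟨i, j⟩, hmem, hmax⟩ := C.exists_max_image (fun c => ((c.2 : ℕ) : ℤ) - (c.1 : ℕ)) hCne
  obtain ⟨hik, hkj, hf, hconf⟩ : (i : ℕ) + 1 < k ∧ k < (j : ℕ) ∧ Equiv.swap i j ∈ R x w ∧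
      Equiv.swap i j ∉ R (x * Equiv.swap a b) w := by simpa [C] using hmem
  have hmax' : ∀ i' j' : Fin n, (i' : ℕ) + 1 < k → k < (j' : ℕ) → Equiv.swap i' j' ∈ R x w →
      Equiv.swap i' j' ∉ R (x * Equiv.swap a b) w →
      ((j' : ℕ) : ℤ) - (i' : ℕ) ≤ ((j : ℕ) : ℤ) - (i : ℕ) := fun i' j' h1 h2 h3 h4 =>
    hmax (i', j') (by simpa [C] using ⟨h1, h2, h3, h4⟩)
  have hij : i < j := by rw [Fin.lt_def]; omega
  have hia : i ≠ a := hne _ _ (by omega)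
  have hib : i ≠ b := hne _ _ (by omega)
  have hja : j ≠ a := hne _ _ (by omega)
  have hjb : j ≠ b := hne _ _ (by omega)
  by_cases hi0 : (i : ℕ) = 0
  · obtain rfl : i = z := Fin.ext (by omega)
    by_cases hjn : (j : ℕ) + 1 = n
    · obtain rfl : j = e := Fin.ext (by omega)
      exact hconf hsx
    · exact not_mem_of_move_right hmsp hkm hx hab ht hij (by rw [Fin.lt_def]; omega) hia hib hja
        hjb (hne _ _ (by omega)) (hne _ _ (by omega)) hf hs hconf hsx
  by_cases hjn : (j : ℕ) + 1 = n
  · obtain rfl : j = e := Fin.ext (by omega)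
    exact not_mem_of_move_left hmsp hkm hx hab ht hij (by rw [Fin.lt_def]; omega) hia hib hja
      hjb (hne _ _ (by omega)) (hne _ _ (by omega)) hf hs hconf hsx
  obtain ⟨i', hi'⟩ : ∃ i' : Fin n, (i' : ℕ) + 1 = i := ⟨⟨i - 1, by omega⟩, by simp; omega⟩
  obtain ⟨j', hj'⟩ : ∃ j' : Fin n, (j : ℕ) + 1 = j' := ⟨⟨j + 1, by omega⟩, rfl⟩
  have hleft : Equiv.swap i' j ∉ R x w := fun h => by
    have := hmax' i' j (by omega) hkj h
      (not_mem_of_move_left hmsp hkm hx hab ht hij (by rw [Fin.lt_def]; omega) hia hib hja hjb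
        (hne _ _ (by omega)) (hne _ _ (by omega)) hf h hconf)
    omega
  have hright : Equiv.swap i j' ∉ R x w := fun h => by
    have := hmax' i j' hik (by omega) h
      (not_mem_of_move_right hmsp hkm hx hab ht hij (by rw [Fin.lt_def]; omega) hia hib hja hjb
        (hne _ _ (by omega)) (hne _ _ (by omega)) hf h hconf)
    omega
  have hmid := fun p hp1 hp2 => two_le_dxw_of_stuck hxw hkm hx hdelta (p := p)
    (show (i : ℕ) < k by omega) hkj.le (by omega) (by omega)
    (apply_lt_of_notMem hxw hkm hx hdelta hi' hij hf hleft)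
    (le_of_notMem hxw hkm hx hdelta hj' hij hf hright) hp1 hp2
  obtain ⟨hvf, hboxf⟩ := (swap_mem_R_iff hxw hij).1 hf
  have hiz : i ≠ z := hne _ _ (by omega)
  have hie : i ≠ e := hne _ _ (by omega)
  have hjz : j ≠ z := hne _ _ (by omega)
  have hje : j ≠ e := hne _ _ (by omega)
  have haz : a ≠ z := hne _ _ (by omega)
  have hae : a ≠ e := hne _ _ (by omega)
  have hbz : b ≠ z := hne _ _ (by omega)
  have hbe : b ≠ e := hne _ _ (by omega)
  have hfs : Equiv.swap i j ∈ R (x * Equiv.swap z e) w := by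
    rw [swap_mem_R_mul_swap_iff hxw hze hs hij hiz hie hjz hje]
    refine ⟨hvf, fun p q hpq => ?_⟩
    have h1 := hboxf p q hpq
    split_ifs with hin
    · simp only [InBox] at hpq hin
      obtain rfl : q = k + 1 := by omega
      have := hmid p hpq.1 hpq.2.1
      omega
    · omega
  have hn : NoneBetween (x * Equiv.swap z e) a b := by
    intro c h1 h2
    rw [Fin.lt_def] at h1 h2
    omega
  have hz' := mem_R_mul_swap_of_disjoint hs.2.2 (hmsp.2.2 _ hs) hab hts hn hia hib hja hjb hfs
  have va : (x * Equiv.swap z e) a = x a := by simp [Equiv.swap_apply_of_ne_of_ne haz hae]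
  have vb : (x * Equiv.swap z e) b = x b := by simp [Equiv.swap_apply_of_ne_of_ne hbz hbe]
  have ui : (x * Equiv.swap z e * Equiv.swap a b) i = x i := by
    simp [Equiv.swap_apply_of_ne_of_ne hia hib, Equiv.swap_apply_of_ne_of_ne hiz hie]
  have uj : (x * Equiv.swap z e * Equiv.swap a b) j = x j := by
    simp [Equiv.swap_apply_of_ne_of_ne hja hjb, Equiv.swap_apply_of_ne_of_ne hjz hje]
  rw [swap_mem_R_iff hts.2.2 hij, ui, uj] at hz'
  apply hconf
  rw [swap_mem_R_mul_swap_iff hxw hab ht hij hia hib hja hjb]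
  refine ⟨hvf, fun p q hpq => ?_⟩
  have h1 := hz'.2 p q (by simp only [InBox, ui, uj]; exact hpq)
  rw [dxw_mul_swap _ w hab ((swap_mem_R_iff hs.2.2 hab).1 hts).1, dxw_mul_swap x w hze hvs] at h1
  simp only [InBox, va, vb] at h1 ⊢
  split_ifs at h1 ⊢ <;> omega

/-- The values of `w` on the first decreasing block after the first position. -/
lemma apply_eq_of_lt {k n : ℕ} {w : Equiv.Perm (Fin n)}
    (hcov : ∀ i : Fin n, (i : ℕ) < k → k ≤ (w i : ℕ) + i)
    (hlt : ∀ i : Fin n, 0 < (i : ℕ) → (i : ℕ) < k → (w i : ℕ) < k) :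
    ∀ s : ℕ, ∀ i : Fin n, (i : ℕ) = s → 0 < s → s < k → (w i : ℕ) + s = k := by
  intro s
  induction s using Nat.strong_induction_on with
  | _ s ih =>
    intro i his hs0 hsk
    have h1 := hcov i (by omega)
    have h2 := hlt i (by omega) (by omega)
    by_contra hne
    let c : Fin n := ⟨k - w i, by omega⟩
    have hc : (c : ℕ) = k - w i := rfl
    have h3 := ih c (by omega) c rfl (by omega) (by omega)
    have h4 : c = i := w.injective (Fin.ext (by omega))
    rw [h4] at hc
    omega

/-- The values of `w` on the second decreasing block before the last position. -/
lemma apply_eq_of_le {k n : ℕ} {w : Equiv.Perm (Fin n)}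
    (hcov : ∀ c : Fin n, k ≤ (w c : ℕ) → (c : ℕ) + w c + 1 < k + n)
    (hle : ∀ c : Fin n, (c : ℕ) < k → k ≤ (w c : ℕ) → (w c : ℕ) + 1 = n) :
    ∀ s : ℕ, ∀ i : Fin n, (i : ℕ) = s → k ≤ s → s + 1 < n → (w i : ℕ) + s + 2 = k + n := by
  intro s
  induction s using Nat.strong_induction_on with
  | _ s ih =>
    intro i his hks hsn
    let c : Fin n := w.symm ⟨k + n - 2 - s, by omega⟩
    have hc : (w c : ℕ) = k + n - 2 - s := by simp [c]
    have h1 := hcov c (by omega)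
    have h2 := hle c
    by_cases hci : (c : ℕ) = s
    · rw [← Fin.ext (hci.trans his.symm)]
      omega
    · have := ih c (by omega) c rfl (by omega) (by omega)
      omega

/-- If `x` is an MSP for `w` with `Δ(x,w) = {1,…,n}` and `x` consists of exactly two
decreasing sequences `x = [k,…,1, k+m,…,k+1]` (with `k,m ≥ 1`, `k + m = n`), then
`k ≥ 2`, `m ≥ 2`, and `w = [k+m, k,…,2, k+m−1,…,k+1, 1]`. -/
theorem msp_two_decreasing {n : ℕ} (x w : Equiv.Perm (Fin n)) (hmsp : MSP x w)
    (hdelta : Delta x w = Set.univ) (k m : ℕ) (hk : 1 ≤ k) (hm : 1 ≤ m)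
    (hkm : k + m = n) (hx : ∀ i : Fin n, (x i : ℕ) = xkmVal k m (i : ℕ)) :
    2 ≤ k ∧ 2 ≤ m ∧ ∀ i : Fin n, (w i : ℕ) = wkmVal k m (i : ℕ) := by
  have hxw := hmsp.1
  obtain ⟨a, ha⟩ : ∃ a : Fin n, (a : ℕ) + 1 = k := ⟨⟨k - 1, by omega⟩, by simp; omega⟩
  obtain ⟨b, hb⟩ : ∃ b : Fin n, (b : ℕ) = k := ⟨⟨k, by omega⟩, rfl⟩
  obtain ⟨z, hz⟩ : ∃ z : Fin n, (z : ℕ) = 0 := ⟨⟨0, by omega⟩, rfl⟩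
  obtain ⟨i₀, j₀, hi₀, hj₀, -⟩ := exists_conflict hmsp hkm hx ha hb
    (inner_swap_mem_R hxw hkm hx hdelta ha hb)
  have hk2 : 2 ≤ k := by omega
  have hm2 : 2 ≤ m := by omega
  refine ⟨hk2, hm2, ?_⟩
  have hcov1 := fun c : Fin n => le_apply_add hxw hkm hx hdelta (i := c)
  have hcov2 := fun c : Fin n => add_apply_lt hxw hkm hx hdelta (c := c)
  have hx0 : rank x k (k + 1) = 0 := by
    rw [rank, Finset.card_eq_zero, Finset.filter_eq_empty_iff]
    rintro c - hc
    have := apply_of_lt hx (show (c : ℕ) < k by omega)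
    omega
  have hw1 := dxw_middle_le_one hmsp hkm hx hdelta hk2 hm2
  rw [dxw, hx0] at hw1
  have hwz := hcov1 z (by omega)
  have hlt : ∀ i : Fin n, 0 < (i : ℕ) → (i : ℕ) < k → (w i : ℕ) < k := by
    intro i h0 hik
    by_contra! hge
    have : 2 ≤ rank w k (k + 1) := by
      rw [rank]
      refine two_le_card_filter (c := z) (e := i) ?_ ⟨?_, ?_⟩ ⟨?_, ?_⟩
      · rw [ne_eq, Fin.ext_iff]
        omega
      all_goals omega
    omega
  have hwz' : (w z : ℕ) + 1 = n := by
    let c : Fin n := w.symm ⟨n - 1, by omega⟩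
    have hc : (w c : ℕ) = n - 1 := by simp [c]
    have h1 := hcov2 c (by omega)
    have h2 := hlt c
    obtain h3 : c = z := Fin.ext (by omega)
    rw [← h3]
    omega
  have hfirst := apply_eq_of_lt hcov1 hlt
  have hsecond := apply_eq_of_le hcov2 fun c h1 h2 => by
    have h3 := hlt c
    obtain rfl : c = z := Fin.ext (by omega)
    exact hwz'
  intro i
  rw [wkmVal]
  split_ifs with h0 h1 h2
  · obtain rfl : i = z := Fin.ext (by omega)
    omega
  · have := hfirst i i rfl (by omega) h1
    omega
  · have := hsecond i i rfl (by omega) (by omega)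
    omega
  · let c : Fin n := w.symm z
    have hc : (w c : ℕ) = 0 := by simp [c, hz]
    have h3 := hfirst c c rfl
    have h4 := hsecond c c rfl
    have h5 : (c : ℕ) ≠ 0 := fun h => by
      obtain h6 : c = z := Fin.ext (by omega)
      rw [h6] at hc
      omega
    obtain h6 : i = c := Fin.ext (by omega)
    rw [h6, hc]

end BSW
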